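/- Fix a field F. For every k ≥ 2, let J_k be the join Δ * Δ' of two vertex-disjoint copies Δ, Δ' of the boundary complex of the k-simplex (the complex of all proper subsets of a (k+1)-element set). Then: (a) every missing face of J_k has dimension exactly k; (b) J_k is resolution i-chordal over F for every i with k ≤ i ≤ 2k−2; and (c) J_k is not k-Leray over F (indeed H̃_{2k−1}(J_k; F) ≠ 0). In particular, the hypothesis range [k, 2k−1] in the Propagation Theorem cannot be shortened to [k, 2k−2]. -/

import Mathlib

/-!
Basic notions for homological chordality of simplicial complexes,
following Adiprasito–Nevo–Samper, "Higher chordality: From graphs to complexes".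

A finite abstract simplicial complex is modelled as a downward-closed finite
family of finite subsets of a vertex type `V`.  Chains of dimension `k` (with
coefficients in a commutative ring `R`) are functions `Finset V → R` supported
on faces of cardinality `k + 1`; the simplicial boundary operator includes the
augmentation (so `0`-cycles are *reduced* cycles), matching the paper's
convention that `C₋₁` is generated by the empty face.
-/

open Finset

attribute [local instance] Classical.propDecidable

noncomputable section

/-- A finite abstract simplicial complex with vertices in `V`:
a downward-closed finite family of finite subsets of `V`. -/
structure ASC (V : Type*) where
  faces : Finset (Finset V)
  down_closed : ∀ ⦃s t : Finset V⦄, s ∈ faces → t ⊆ s → t ∈ faces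

variable {V : Type*} [Fintype V] [LinearOrder V]

/-- `(-1)` to the number of elements of `t` smaller than `v`; this is the sign
of the position of `v` in the ordered set `insert v t`. -/
def esign (v : V) (t : Finset V) : ℤ :=
  (-1) ^ (t.filter fun w => w < v).card

/-- The simplicial boundary operator (including the augmentation at the empty
face): `(bdry c) t = ∑_{v ∉ t} ± c (insert v t)`. -/
def bdry {R : Type*} [CommRing R] (c : Finset V → R) : Finset V → R :=
  fun t => ∑ v ∈ tᶜ, esign v t • c (insert v t)

/-- `c` is a chain of dimension `k` on the set of faces `S`:
it is supported on members of `S` of cardinality `k + 1`. -/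
def IsChainOn {R : Type*} [CommRing R] (S : Set (Finset V)) (k : ℤ)
    (c : Finset V → R) : Prop :=
  ∀ s : Finset V, c s ≠ 0 → s ∈ S ∧ (s.card : ℤ) = k + 1

/-- The vertex support `c⁰` of a chain: all vertices lying in a face with a
nonzero coefficient. -/
def vsupp {R : Type*} [CommRing R] (c : Finset V → R) : Set V :=
  {v | ∃ s : Finset V, c s ≠ 0 ∧ v ∈ s}

/-- Vanishing of the `k`-th (reduced) homology of the family of faces `S` over `R`:
every `k`-cycle is the boundary of a `(k+1)`-chain. -/
def HVanish (R : Type*) [CommRing R] (S : Set (Finset V)) (k : ℤ) : Prop :=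
  ∀ z : Finset V → R, IsChainOn S k z → bdry z = 0 →
    ∃ c : Finset V → R, IsChainOn S (k + 1) c ∧ bdry c = z

/-- `Δ` is resolution `k`-chordal over `R`: every `k`-cycle `z` of `Δ` admits a
resolution, i.e. a `(k+1)`-chain `c` of `Δ` with `∂c = z` and the same vertex
support as `z`. -/
def ResChordal (R : Type*) [CommRing R] (Δ : ASC V) (k : ℤ) : Prop :=
  ∀ z : Finset V → R, IsChainOn (↑Δ.faces) k z → bdry z = 0 →
    ∃ c : Finset V → R, IsChainOn (↑Δ.faces) (k + 1) c ∧ bdry c = z ∧ vsupp c = vsupp z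

/-- `z` is a complete `k`-cycle on the face set `S`: it is a `k`-cycle whose
faces with nonzero coefficient are precisely all the `k`-dimensional faces of
some set `W` of `k + 2` vertices, and all those faces belong to `S`. -/
def IsCompleteCycleOn {R : Type*} [CommRing R] (S : Set (Finset V)) (k : ℤ)
    (z : Finset V → R) : Prop :=
  bdry z = 0 ∧ ∃ W : Finset V, (W.card : ℤ) = k + 2 ∧
    (∀ s : Finset V, z s ≠ 0 ↔ s ⊆ W ∧ (s.card : ℤ) = k + 1) ∧
    ∀ s : Finset V, s ⊆ W → (s.card : ℤ) = k + 1 → s ∈ S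

/-- `Δ` is decomposition `k`-chordal over `R`: every `k`-cycle `z` of `Δ` is a
sum of complete `k`-cycles of `Δ` supporting only vertices supported in `z`. -/
def DecChordal (R : Type*) [CommRing R] (Δ : ASC V) (k : ℤ) : Prop :=
  ∀ z : Finset V → R, IsChainOn (↑Δ.faces) k z → bdry z = 0 →
    ∃ (n : ℕ) (zs : Fin n → Finset V → R),
      z = ∑ i, zs i ∧
      ∀ i, IsCompleteCycleOn (↑Δ.faces) k (zs i) ∧ vsupp (zs i) ⊆ vsupp z

/-- `σ` is a missing face (minimal nonface) of `Δ`: `σ` is not a face but all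
its proper subsets are.  Its dimension is `σ.card - 1`. -/
def IsMissingFace (Δ : ASC V) (σ : Finset V) : Prop :=
  σ ∉ Δ.faces ∧ ∀ t ⊂ σ, t ∈ Δ.faces

/-- The induced subcomplex `Δ|W` on a subset `W` of the vertices. -/
def induced (Δ : ASC V) (W : Finset V) : ASC V where
  faces := Δ.faces.filter fun s => s ⊆ W
  down_closed := by
    intro s t hs hts
    simp only [mem_filter] at hs ⊢
    exact ⟨Δ.down_closed hs.1 hts, hts.trans hs.2⟩

/-- `Δ` is `k`-Leray over `R`: the reduced homology `H̃ⱼ(Δ|W; R)` vanishes for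
every `j ≥ k` and every vertex subset `W`. -/
def IsLeray (R : Type*) [CommRing R] (Δ : ASC V) (k : ℤ) : Prop :=
  ∀ (W : Finset V) (j : ℤ), k ≤ j → HVanish R (((induced Δ W).faces : Set (Finset V))) j

/-- The closed star `St_σ Δ = ∪_{σ ⊆ τ ∈ Δ} 2^τ`. -/
def star (Δ : ASC V) (σ : Finset V) : ASC V where
  faces := Δ.faces.filter fun s => ∃ τ ∈ Δ.faces, σ ⊆ τ ∧ s ⊆ τ
  down_closed := by
    intro s t hs hts
    simp only [mem_filter] at hs ⊢
    obtain ⟨h1, τ', h2, h3, h4⟩ := hs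
    exact ⟨Δ.down_closed h1 hts, τ', h2, h3, hts.trans h4⟩

/-- The deletion `Δ - σ`: the maximal subcomplex of `Δ` not containing `σ`. -/
def del (Δ : ASC V) (σ : Finset V) : ASC V where
  faces := Δ.faces.filter fun s => ¬ σ ⊆ s
  down_closed := by
    intro s t hs hts
    simp only [mem_filter] at hs ⊢
    exact ⟨Δ.down_closed hs.1 hts, fun h => hs.2 (h.trans hts)⟩

/-- The extended link `eLk_σ Δ = St_σ Δ - σ`. -/
def eLk (Δ : ASC V) (σ : Finset V) : ASC V := del (star Δ σ) σ

/-- The link `Lk_σ Δ = {τ \ σ : σ ⊆ τ ∈ Δ}`. -/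
def link (Δ : ASC V) (σ : Finset V) : ASC V where
  faces := Finset.univ.filter fun t => Disjoint σ t ∧ σ ∪ t ∈ Δ.faces
  down_closed := by
    intro s t hs hts
    simp only [mem_filter, mem_univ, true_and] at hs ⊢
    exact ⟨hs.1.mono_right hts, Δ.down_closed hs.2 (union_subset_union_right hts)⟩

/-- The `k`-clique complex `Cl_k Δ`: faces are the sets of vertices of `Δ` all
of whose subsets of cardinality at most `k + 1` are faces of `Δ`. -/
def clique (Δ : ASC V) (k : ℤ) : ASC V where
  faces := Finset.univ.filter fun s =>
    (∀ v ∈ s, {v} ∈ Δ.faces) ∧ ∀ t ⊆ s, (t.card : ℤ) ≤ k + 1 → t ∈ Δ.faces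
  down_closed := by
    intro s t hs hts
    simp only [mem_filter, mem_univ, true_and] at hs ⊢
    exact ⟨fun v hv => hs.1 v (hts hv), fun u hu hc => hs.2 u (hu.trans hts) hc⟩

/-- The vertex set of a complex, as a set of elements of `V`. -/
def vertexSet (Δ : ASC V) : Set V := {v | {v} ∈ Δ.faces}

/-- The relative simplicial complex `(Δ, Γ)` is resolution `k`-chordal over `R`:
every relative `k`-cycle (a `k`-chain of `Δ` supported off `Γ` whose boundary
is a chain of `Γ`) admits a resolution, i.e. a `(k+1)`-chain `c` of `Δ`
supported off `Γ` with `∂c ≡ z` modulo chains of `Γ` and `vsupp c = vsupp z`. -/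
def RelResChordal (R : Type*) [CommRing R] (Δ Γ : ASC V) (k : ℤ) : Prop :=
  ∀ z : Finset V → R, IsChainOn (↑Δ.faces) k z → (∀ s, z s ≠ 0 → s ∉ Γ.faces) →
    IsChainOn (↑Γ.faces) (k - 1) (bdry z) →
    ∃ c : Finset V → R, IsChainOn (↑Δ.faces) (k + 1) c ∧ (∀ s, c s ≠ 0 → s ∉ Γ.faces) ∧
      IsChainOn (↑Γ.faces) k (bdry c - z) ∧ vsupp c = vsupp z

/-- The union of two simplicial complexes (taken facewise). -/
def aunion (Δ Γ : ASC V) : ASC V where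
  faces := Δ.faces ∪ Γ.faces
  down_closed := by
    intro s t hs hts
    rcases Finset.mem_union.1 hs with h | h
    · exact Finset.mem_union.2 (Or.inl (Δ.down_closed h hts))
    · exact Finset.mem_union.2 (Or.inr (Γ.down_closed h hts))

/-- The intersection of two simplicial complexes (taken facewise). -/
def ainter (Δ Γ : ASC V) : ASC V where
  faces := Δ.faces ∩ Γ.faces
  down_closed := by
    intro s t hs hts
    rw [Finset.mem_inter] at hs ⊢
    exact ⟨Δ.down_closed hs.1 hts, Γ.down_closed hs.2 hts⟩

/-- The `k`-skeleton of `Δ`: all faces of dimension at most `k`. -/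
def skel (Δ : ASC V) (k : ℤ) : ASC V where
  faces := Δ.faces.filter fun s => (s.card : ℤ) ≤ k + 1
  down_closed := by
    intro s t hs hts
    simp only [mem_filter] at hs ⊢
    refine ⟨Δ.down_closed hs.1 hts, le_trans ?_ hs.2⟩
    exact_mod_cast Finset.card_le_card hts

/-- The complex `𝔍_k`: the join of two vertex-disjoint copies of the boundary
complex of the `k`-simplex (each a proper-subset complex of a `(k+1)`-element
vertex set).  The first copy lives on the vertices `0, …, k` of `Fin (2k+2)`,
the second on `k+1, …, 2k+1`. -/
def Jcomplex (k : ℕ) : ASC (Fin (2 * k + 2)) where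
  faces := Finset.univ.filter fun s =>
    ¬ (Finset.univ.filter fun i : Fin (2 * k + 2) => (i : ℕ) ≤ k) ⊆ s ∧
    ¬ (Finset.univ.filter fun i : Fin (2 * k + 2) => k < (i : ℕ)) ⊆ s
  down_closed := by
    intro s t hs hts
    simp only [mem_filter, mem_univ, true_and] at hs ⊢
    exact ⟨fun h => hs.1 (h.trans hts), fun h => hs.2 (h.trans hts)⟩

/-- The cone operator with apex `a`, adjoining `a` to every face avoiding it. -/
def coneOp {R : Type*} [CommRing R] (a : V) (c : Finset V → R) : Finset V → R :=
  fun s => if a ∈ s then esign a (s.erase a) • c (s.erase a) else 0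

/-- The part of a chain supported on the faces containing `A`. -/
def restrictSup {R : Type*} [CommRing R] (A : Finset V) (c : Finset V → R) : Finset V → R :=
  fun s => if A ⊆ s then c s else 0

theorem esign_mul_self {W : Type*} [LinearOrder W] (v : W) (t : Finset W) :
    esign v t * esign v t = 1 := by
  unfold esign
  rw [← mul_pow]
  simp

theorem esign_insert {W : Type*} [LinearOrder W] {v a : W} {t : Finset W}
    (ha : a ∉ t) :
    esign v (insert a t) = (if a < v then -1 else 1) * esign v t := by
  unfold esign
  rw [Finset.filter_insert]
  split_ifs with h
  · rw [Finset.card_insert_of_notMem (by simp [ha]), pow_succ, mul_comm]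
  · rw [one_mul]

theorem esign_insert_mul_esign_insert {W : Type*} [LinearOrder W] {v a : W} {t : Finset W}
    (hva : v ≠ a) (hv : v ∉ t) (ha : a ∉ t) :
    esign v (insert a t) * esign a (insert v t) = -(esign a t * esign v t) := by
  rw [esign_insert ha, esign_insert hv]
  rcases lt_or_gt_of_ne hva with h | h
  · simp [h, h.not_gt, mul_comm]
  · simp [h, h.not_gt, mul_comm]

section Operators

variable {R : Type*} [CommRing R]

theorem bdry_zero : bdry (0 : Finset V → R) = 0 := by
  funext t
  simp [bdry]

theorem bdry_sub (c d : Finset V → R) : bdry (c - d) = bdry c - bdry d := by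
  funext t
  simp [bdry, smul_sub, Finset.sum_sub_distrib]

theorem exists_insert_ne_zero_of_bdry_ne_zero {c : Finset V → R} {t : Finset V}
    (h : bdry c t ≠ 0) : ∃ v, v ∉ t ∧ c (insert v t) ≠ 0 := by
  obtain ⟨v, hv, hne⟩ := Finset.exists_ne_zero_of_sum_ne_zero h
  exact ⟨v, by simpa using hv, fun h0 => hne (by simp [h0])⟩

theorem bdry_bdry (c : Finset V → R) : bdry (bdry c) = 0 := by
  funext t
  simp only [bdry, Finset.smul_sum, Pi.zero_apply]
  rw [Finset.sum_sigma']
  refine Finset.sum_involution (fun p _ => ⟨p.2, p.1⟩) ?_ ?_ ?_ ?_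
  · rintro ⟨v, w⟩ h
    simp only [Finset.mem_sigma, Finset.mem_compl, Finset.mem_insert, not_or] at h
    obtain ⟨hv, hwv, hw⟩ := h
    have hcomm : insert w (insert v t) = insert v (insert w t) := Finset.insert_comm _ _ _
    simp only [smul_smul]
    rw [hcomm, ← add_smul]
    have hsign : esign v t * esign w (insert v t) + esign w t * esign v (insert w t) = 0 := by
      rw [esign_insert hv, esign_insert hw]
      rcases lt_or_gt_of_ne hwv with h | h
      · simp [h, h.not_gt, mul_comm]
      · simp [h, h.not_gt, mul_comm]
    rw [hsign, zero_smul]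
  · rintro ⟨v, w⟩ h _ heq
    simp only [Finset.mem_sigma, Finset.mem_compl, Finset.mem_insert, not_or] at h
    simp only [Sigma.mk.injEq] at heq
    exact h.2.1 heq.1
  · rintro ⟨v, w⟩ h
    simp only [Finset.mem_sigma, Finset.mem_compl, Finset.mem_insert, not_or] at h ⊢
    exact ⟨h.2.2, fun h' => h.2.1 h'.symm, h.1⟩
  · rintro ⟨v, w⟩ h
    rfl

/-- Coning with apex `a` is a contracting homotopy of the full simplex. -/
theorem bdry_coneOp_add_coneOp_bdry (a : V) (c : Finset V → R) :
    bdry (coneOp a c) + coneOp a (bdry c) = c := by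
  funext t
  by_cases ha : a ∈ t
  · obtain ⟨r, har, rfl⟩ : ∃ r, a ∉ r ∧ insert a r = t :=
      ⟨t.erase a, Finset.notMem_erase a t, Finset.insert_erase ha⟩
    have hcompl : rᶜ = insert a (insert a r)ᶜ := by
      ext x
      by_cases hx : x = a <;> simp [hx, har]
    simp only [Pi.add_apply, coneOp, bdry, Finset.mem_insert_self, if_true,
      Finset.erase_insert har]
    rw [hcompl, Finset.sum_insert (by simp), smul_add, smul_smul, esign_mul_self, one_smul,
      add_left_comm, Finset.smul_sum, ← Finset.sum_add_distrib, Finset.sum_eq_zero, add_zero]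
    intro v hv
    simp only [Finset.mem_compl, Finset.mem_insert, not_or] at hv
    have he : (insert v (insert a r)).erase a = insert v r := by
      rw [Finset.insert_comm, Finset.erase_insert]
      simp [har, Ne.symm hv.1]
    rw [if_pos (by simp), he, smul_smul, smul_smul, ← add_smul,
      esign_insert_mul_esign_insert hv.1 hv.2 har, neg_add_cancel, zero_smul]
  · simp only [Pi.add_apply, coneOp, bdry, if_neg ha, add_zero]
    rw [Finset.sum_eq_single a]
    · rw [if_pos (Finset.mem_insert_self _ _), Finset.erase_insert ha, smul_smul,
        esign_mul_self, one_smul]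
    · intro v _ hva
      rw [if_neg (by simp [ha, Ne.symm hva]), smul_zero]
    · intro h
      exact absurd (Finset.mem_compl.2 ha) h

theorem bdry_coneOp_of_bdry_eq_zero (a : V) {z : Finset V → R} (hz : bdry z = 0) :
    bdry (coneOp a z) = z := by
  have h := bdry_coneOp_add_coneOp_bdry a z
  have h0 : coneOp a (0 : Finset V → R) = 0 := by
    funext t
    simp [coneOp]
  rwa [hz, h0, add_zero] at h

theorem mem_and_ne_zero_of_coneOp_ne_zero {W : Type*} [LinearOrder W] {a : W}
    {c : Finset W → R} {s : Finset W}
    (h : coneOp a c s ≠ 0) : a ∈ s ∧ c (s.erase a) ≠ 0 := by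
  unfold coneOp at h
  split_ifs at h with ha
  · exact ⟨ha, fun h0 => h (by simp [h0])⟩
  · exact absurd rfl h

theorem bdry_restrictSup_of_subset {A s : Finset V} (hA : A ⊆ s) (c : Finset V → R) :
    bdry (restrictSup A c) s = bdry c s := by
  refine Finset.sum_congr rfl fun v _ => ?_
  rw [restrictSup, if_pos (hA.trans (Finset.subset_insert v s))]

theorem subset_and_ne_zero_of_restrictSup_ne_zero {W : Type*} {A s : Finset W} {c : Finset W → R}
    (h : restrictSup A c s ≠ 0) : A ⊆ s ∧ c s ≠ 0 := by
  unfold restrictSup at h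
  split_ifs at h with hA
  · exact ⟨hA, h⟩
  · exact absurd rfl h

theorem vsupp_bdry_subset (c : Finset V → R) : vsupp (bdry c) ⊆ vsupp c := by
  rintro v ⟨s, hs, hv⟩
  obtain ⟨w, _, hw⟩ := exists_insert_ne_zero_of_bdry_ne_zero hs
  exact ⟨insert w s, hw, Finset.mem_insert_of_mem hv⟩

end Operators

section Join

variable {R : Type*} [CommRing R] {Δ : ASC V} {A B : Finset V}

/-- If the support of `z` does not contain `A`, then `z` is a cycle in a cone. -/
theorem exists_resolution_of_not_subset_vsupp
    (hΔ : ∀ s, s ∈ Δ.faces ↔ ¬ A ⊆ s ∧ ¬ B ⊆ s) (hAB : Disjoint A B)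
    (hU : ∀ x, x ∈ A ∨ x ∈ B) {i : ℤ} (hi : (B.card : ℤ) ≤ i + 1) {z : Finset V → R}
    (hz : IsChainOn (↑Δ.faces) i z) (hdz : bdry z = 0) (hA : ¬ (A : Set V) ⊆ vsupp z) :
    ∃ c : Finset V → R, IsChainOn (↑Δ.faces) (i + 1) c ∧ bdry c = z ∧ vsupp c = vsupp z := by
  by_cases hex : ∃ a ∈ A, a ∈ vsupp z
  · obtain ⟨a, haA, haz⟩ := hex
    have hsub : vsupp (coneOp a z) ⊆ vsupp z := by
      rintro v ⟨s, hs, hv⟩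
      by_cases hva : v = a
      · exact hva ▸ haz
      · exact ⟨s.erase a, (mem_and_ne_zero_of_coneOp_ne_zero hs).2, Finset.mem_erase.2 ⟨hva, hv⟩⟩
    have hb := bdry_coneOp_of_bdry_eq_zero a hdz
    refine ⟨coneOp a z, fun s hs => ?_, hb, hsub.antisymm ?_⟩
    · obtain ⟨has, hzs⟩ := mem_and_ne_zero_of_coneOp_ne_zero hs
      obtain ⟨hface, hcard⟩ := hz _ hzs
      have hpos := Finset.card_erase_add_one has
      refine ⟨(hΔ s).2 ⟨fun h => hA fun x hx => hsub ⟨s, hs, h hx⟩, fun h => ?_⟩, by omega⟩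
      exact ((hΔ _).1 hface).2 (Finset.subset_erase.2 ⟨h, Finset.disjoint_left.1 hAB haA⟩)
    · conv_lhs => rw [← hb]
      exact vsupp_bdry_subset _
  · push Not at hex
    have hz0 : z = 0 := by
      funext s
      by_contra hs
      obtain ⟨hface, hcard⟩ := hz s hs
      have hsB : s ⊆ B := fun x hx => by
        exact (hU x).resolve_left fun hxA => hex x hxA ⟨s, hs, hx⟩
      exact ((hΔ s).1 hface).2 (Finset.eq_of_subset_of_card_le hsB (by omega)).ge
    subst hz0
    exact ⟨0, fun s hs => absurd rfl hs, bdry_zero, rfl⟩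

/-- The join of two simplex boundaries has no homology below the top dimension. -/
theorem hVanish_join (hΔ : ∀ s, s ∈ Δ.faces ↔ ¬ A ⊆ s ∧ ¬ B ⊆ s) (hAB : Disjoint A B)
    (hU : ∀ x, x ∈ A ∨ x ∈ B) (hA : A.Nonempty) (hB : B.Nonempty) {i : ℤ}
    (hi : i + 3 < Fintype.card V) : HVanish R (Δ.faces : Set (Finset V)) i := by
  intro z hz hdz
  obtain ⟨a, ha⟩ := hA
  obtain ⟨b, hb⟩ := hB
  have hbA : b ∉ A := Finset.disjoint_right.1 hAB hb
  have haB : a ∉ B := Finset.disjoint_left.1 hAB ha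
  set c := coneOp a z with hc
  set e := restrictSup A (coneOp b c) with he
  have hbc : bdry c = z := bdry_coneOp_of_bdry_eq_zero a hdz
  have hccard : ∀ s, c s ≠ 0 → (s.card : ℤ) = i + 2 := fun s hs => by
    obtain ⟨has, hzs⟩ := mem_and_ne_zero_of_coneOp_ne_zero hs
    have h1 := (hz _ hzs).2
    have h2 := Finset.card_erase_add_one has
    omega
  have hecard : ∀ s, e s ≠ 0 → (s.card : ℤ) = i + 3 := fun s hs => by
    obtain ⟨hbs, hcs⟩ := mem_and_ne_zero_of_coneOp_ne_zero
      (subset_and_ne_zero_of_restrictSup_ne_zero hs).2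
    have h1 := hccard _ hcs
    have h2 := Finset.card_erase_add_one hbs
    omega
  refine ⟨c - bdry e, fun s hs => ⟨(hΔ s).2 ⟨fun hAs => hs ?_, fun hBs => hs ?_⟩, ?_⟩, ?_⟩
  · have hcone : coneOp b z s = 0 := by
      by_contra h
      obtain ⟨_, hzs⟩ := mem_and_ne_zero_of_coneOp_ne_zero h
      exact ((hΔ _).1 (hz _ hzs).1).1 (Finset.subset_erase.2 ⟨hAs, hbA⟩)
    have hhom := congrFun (bdry_coneOp_add_coneOp_bdry b c) s
    rw [hbc, Pi.add_apply, hcone, add_zero] at hhom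
    rw [Pi.sub_apply, he, bdry_restrictSup_of_subset hAs, hhom, sub_self]
  · have hcs : c s = 0 := by
      by_contra h
      obtain ⟨_, hzs⟩ := mem_and_ne_zero_of_coneOp_ne_zero h
      exact ((hΔ _).1 (hz _ hzs).1).2 (Finset.subset_erase.2 ⟨hBs, haB⟩)
    have hes : bdry e s = 0 := by
      by_contra h
      obtain ⟨v, _, hv⟩ := exists_insert_ne_zero_of_bdry_ne_zero h
      have huniv : insert v s = Finset.univ := Finset.eq_univ_iff_forall.2 fun x => by
        rcases hU x with hx | hx
        · exact (subset_and_ne_zero_of_restrictSup_ne_zero hv).1 hx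
        · exact Finset.mem_insert_of_mem (hBs hx)
      have h1 := hecard _ hv
      rw [huniv, Finset.card_univ] at h1
      omega
    rw [Pi.sub_apply, hcs, hes, sub_zero]
  · by_cases hcs : c s = 0
    · have hes : bdry e s ≠ 0 := fun h => hs (by rw [Pi.sub_apply, hcs, h, sub_zero])
      obtain ⟨v, hvs, hv⟩ := exists_insert_ne_zero_of_bdry_ne_zero hes
      have h1 := hecard _ hv
      rw [Finset.card_insert_of_notMem hvs] at h1
      push_cast at h1
      omega
    · have h1 := hccard s hcs
      omega
  · rw [bdry_sub, bdry_bdry, sub_zero, hbc]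

theorem resChordal_join (hΔ : ∀ s, s ∈ Δ.faces ↔ ¬ A ⊆ s ∧ ¬ B ⊆ s) (hAB : Disjoint A B)
    (hU : ∀ x, x ∈ A ∨ x ∈ B) (hA : A.Nonempty) (hB : B.Nonempty) {i : ℤ}
    (hAi : (A.card : ℤ) ≤ i + 1) (hBi : (B.card : ℤ) ≤ i + 1)
    (hi : i + 3 < Fintype.card V) : ResChordal R Δ i := by
  intro z hz hdz
  by_cases hAz : (A : Set V) ⊆ vsupp z
  · by_cases hBz : (B : Set V) ⊆ vsupp z
    · obtain ⟨c, hc, rfl⟩ := hVanish_join hΔ hAB hU hA hB hi z hz hdz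
      refine ⟨c, hc, rfl, Set.Subset.antisymm (fun x _ => ?_) (vsupp_bdry_subset c)⟩
      exact (hU x).elim (fun h => hAz h) (fun h => hBz h)
    · exact exists_resolution_of_not_subset_vsupp (fun s => (hΔ s).trans and_comm) hAB.symm
        (fun x => (hU x).symm) hAi hz hdz hBz
  · exact exists_resolution_of_not_subset_vsupp hΔ hAB hU hBi hz hdz hAz

/-- The join of two simplex boundaries carries a nonzero cycle of top dimension. -/
theorem exists_top_cycle_join [Nontrivial R]
    (hΔ : ∀ s, s ∈ Δ.faces ↔ ¬ A ⊆ s ∧ ¬ B ⊆ s) (hAB : Disjoint A B)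
    (hU : ∀ x, x ∈ A ∨ x ∈ B) (hA : A.Nonempty) (hB : B.Nonempty) :
    ∃ z : Finset V → R, IsChainOn (↑Δ.faces) ((Fintype.card V : ℤ) - 3) z ∧
      bdry z = 0 ∧ z ≠ 0 := by
  obtain ⟨a, ha⟩ := hA
  obtain ⟨b, hb⟩ := hB
  have hbA : b ∉ A := Finset.disjoint_right.1 hAB hb
  have haB : a ∉ B := Finset.disjoint_left.1 hAB ha
  have hab : a ≠ b := fun h => hbA (h ▸ ha)
  set u : Finset V → R := fun s => if s = Finset.univ then 1 else 0 with hu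
  have hu_univ : ∀ s, u s ≠ 0 → s = Finset.univ := fun s hs => by
    by_contra h
    exact hs (if_neg h)
  set p := restrictSup A (bdry u) with hp
  have hpcard : ∀ s, p s ≠ 0 → s.card + 1 = Fintype.card V := fun s hs => by
    obtain ⟨v, hvs, hv⟩ := exists_insert_ne_zero_of_bdry_ne_zero
      (subset_and_ne_zero_of_restrictSup_ne_zero hs).2
    rw [← Finset.card_insert_of_notMem hvs, hu_univ _ hv, Finset.card_univ]
  refine ⟨bdry p, fun s hs => ⟨(hΔ s).2 ⟨fun hAs => hs ?_, fun hBs => ?_⟩, ?_⟩, bdry_bdry p, ?_⟩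
  · rw [hp, bdry_restrictSup_of_subset hAs, bdry_bdry, Pi.zero_apply]
  · obtain ⟨v, _, hv⟩ := exists_insert_ne_zero_of_bdry_ne_zero hs
    have huniv : insert v s = Finset.univ := Finset.eq_univ_iff_forall.2 fun x => by
      rcases hU x with hx | hx
      · exact (subset_and_ne_zero_of_restrictSup_ne_zero hv).1 hx
      · exact Finset.mem_insert_of_mem (hBs hx)
    have h1 := hpcard _ hv
    rw [huniv, Finset.card_univ] at h1
    omega
  · obtain ⟨v, hvs, hv⟩ := exists_insert_ne_zero_of_bdry_ne_zero hs
    have h1 := hpcard _ hv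
    rw [Finset.card_insert_of_notMem hvs] at h1
    omega
  · intro h0
    have hs := congrFun h0 ({a, b}ᶜ : Finset V)
    have hia : insert a ({a, b}ᶜ : Finset V) = {b}ᶜ := by
      ext x
      by_cases hx : x = a <;> simp [hx, hab]
    have hib : insert b ({a, b}ᶜ : Finset V) = {a}ᶜ := by
      ext x
      by_cases hx : x = b <;> simp [hx, hab.symm]
    have hpa : p ({a}ᶜ) = 0 := if_neg fun h => by simpa using h ha
    have hpb : p ({b}ᶜ) = esign b ({b}ᶜ) • (1 : R) := by
      have hAb : A ⊆ ({b}ᶜ : Finset V) := fun x hx => by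
        simpa using fun h : x = b => hbA (h ▸ hx)
      have hins : insert b ({b}ᶜ : Finset V) = Finset.univ := by
        ext x
        simp
      rw [hp, restrictSup, if_pos hAb, bdry, compl_compl, Finset.sum_singleton, hins, hu]
      simp
    rw [bdry, compl_compl, Finset.sum_pair hab, hia, hib, hpa, hpb, smul_zero, add_zero,
      smul_smul, Pi.zero_apply] at hs
    have h1 := congrArg
      (fun r : R => (esign a ({a, b}ᶜ) * esign b ({b}ᶜ) : ℤ) • r) hs
    simp only [smul_smul, smul_zero] at h1
    rw [mul_mul_mul_comm, esign_mul_self, esign_mul_self, mul_one, one_smul] at h1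
    exact one_ne_zero h1

end Join

/-- Proposition 5.3 (tightness of the Propagation Theorem): for `k ≥ 2`, the
join `𝔍_k` of two vertex-disjoint boundaries of `k`-simplices
(a) has all its missing faces of dimension exactly `k`,
(b) is resolution `i`-chordal over `F` for all `k ≤ i ≤ 2k - 2`, but
(c) is not `k`-Leray over `F`; indeed `H̃_{2k-1}(𝔍_k; F) ≠ 0`.
Hence the range `[k, 2k-1]` in the Propagation Theorem cannot be shortened. -/
theorem propagation_tightness (F : Type*) [Field F] (k : ℕ) (hk : 2 ≤ k) :
    (∀ σ : Finset (Fin (2 * k + 2)), IsMissingFace (Jcomplex k) σ → σ.card = k + 1) ∧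
    (∀ i : ℤ, (k : ℤ) ≤ i → i ≤ 2 * (k : ℤ) - 2 → ResChordal F (Jcomplex k) i) ∧
    (¬ IsLeray F (Jcomplex k) (k : ℤ) ∧
      ∃ z : Finset (Fin (2 * k + 2)) → F,
        IsChainOn (((Jcomplex k).faces : Set (Finset (Fin (2 * k + 2)))))
          (2 * (k : ℤ) - 1) z ∧ bdry z = 0 ∧
        ¬ ∃ c : Finset (Fin (2 * k + 2)) → F,
            IsChainOn (((Jcomplex k).faces : Set (Finset (Fin (2 * k + 2)))))
              (2 * (k : ℤ)) c ∧ bdry c = z) := by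
  set A : Finset (Fin (2 * k + 2)) := Finset.univ.filter fun i => (i : ℕ) ≤ k with hAdef
  set B : Finset (Fin (2 * k + 2)) := Finset.univ.filter fun i => k < (i : ℕ) with hBdef
  have hΔ : ∀ s, s ∈ (Jcomplex k).faces ↔ ¬ A ⊆ s ∧ ¬ B ⊆ s := fun s => by
    simp only [Jcomplex, Finset.mem_filter, Finset.mem_univ, true_and, hAdef, hBdef]
  have hAB : Disjoint A B := Finset.disjoint_left.2 fun x hxA hxB => by
    simp only [hAdef, hBdef, Finset.mem_filter, Finset.mem_univ, true_and] at hxA hxB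
    omega
  have hU : ∀ x, x ∈ A ∨ x ∈ B := fun x => by
    simp only [hAdef, hBdef, Finset.mem_filter, Finset.mem_univ, true_and]
    omega
  have hAcard : A.card = k + 1 := by
    have h : A = Finset.Iic (⟨k, by omega⟩ : Fin (2 * k + 2)) := by
      ext x
      simp [hAdef, Fin.le_def]
    rw [h, Fin.card_Iic]
  have hBcard : B.card = k + 1 := by
    have h : B = Finset.Ioi (⟨k, by omega⟩ : Fin (2 * k + 2)) := by
      ext x
      simp [hBdef, Fin.lt_def]
    rw [h, Fin.card_Ioi]
    simp only
    omega
  have hA : A.Nonempty := Finset.card_pos.1 (by omega)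
  have hB : B.Nonempty := Finset.card_pos.1 (by omega)
  obtain ⟨z, hz, hdz, hz0⟩ := exists_top_cycle_join (R := F) hΔ hAB hU hA hB
  have hdim : ((Fintype.card (Fin (2 * k + 2)) : ℕ) : ℤ) - 3 = 2 * (k : ℤ) - 1 := by
    rw [Fintype.card_fin]
    push_cast
    ring
  rw [hdim] at hz
  have hnot : ¬ ∃ c : Finset (Fin (2 * k + 2)) → F,
      IsChainOn (((Jcomplex k).faces : Set (Finset (Fin (2 * k + 2))))) (2 * (k : ℤ)) c ∧
        bdry c = z := by
    rintro ⟨c, hc, rfl⟩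
    refine hz0 ?_
    have hc0 : c = 0 := by
      funext s
      by_contra hs
      obtain ⟨hface, hcard⟩ := hc s hs
      obtain ⟨hAs, hBs⟩ := (hΔ s).1 hface
      obtain ⟨a, haA, has⟩ := Finset.not_subset.1 hAs
      obtain ⟨b, hbB, hbs⟩ := Finset.not_subset.1 hBs
      have hab : a ≠ b := fun h => Finset.disjoint_left.1 hAB haA (h ▸ hbB)
      have h := Finset.card_le_univ (insert a (insert b s))
      rw [Finset.card_insert_of_notMem (by simp [hab, has]), Finset.card_insert_of_notMem hbs,
        Fintype.card_fin] at h
      omega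
    rw [hc0, bdry_zero]
  refine ⟨fun σ hσ => ?_, fun i hki hik => ?_, fun hL => ?_, z, hz, hdz, hnot⟩
  · obtain ⟨hnf, hmin⟩ := hσ
    by_cases hAσ : A ⊆ σ
    · rcases hAσ.eq_or_ssubset with h | h
      · rw [← h, hAcard]
      · exact absurd subset_rfl ((hΔ A).1 (hmin A h)).1
    · have hBσ : B ⊆ σ := by
        by_contra h
        exact hnf ((hΔ σ).2 ⟨hAσ, h⟩)
      rcases hBσ.eq_or_ssubset with h | h
      · rw [← h, hBcard]
      · exact absurd subset_rfl ((hΔ B).1 (hmin B h)).2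
  · refine resChordal_join hΔ hAB hU hA hB (by omega) (by omega) ?_
    rw [Fintype.card_fin]
    push_cast
    omega
  · obtain ⟨c, hc, hcz⟩ := hL Finset.univ (2 * (k : ℤ) - 1) (by omega) z
      (fun s hs => ⟨by simpa [induced] using (hz s hs).1, (hz s hs).2⟩) hdz
    refine hnot ⟨c, fun s hs => ⟨?_, ?_⟩, hcz⟩
    · simpa [induced] using (hc s hs).1
    · have h := (hc s hs).2
      omega
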